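/- (One Subcontainer) Let s₁, h₁, sₙ be reals, set z := T(h₁ − T⁻¹(s₁)) and w₁ := w(T⁻¹(s₁), h₁), and suppose 0 < z < sₙ ≤ h₁ ≤ s₁, h₁ ≤ T⁻¹(s₁) + 1, and at least one of the conditions s₁ > 1/√2, w₁ < 2h₁, or s₁² + h₁² + 2sₙ² < 39/25 holds. Then F_{SC₁}(s₁, h₁, sₙ) := s₁² + B₄(T⁻¹(s₁), h₁, w₁, sₙ) + sₙ² + E(s₁, sₙ) > 8/5. -/

import Mathlib

noncomputable section

/-- T⁻¹(s) = √(1 − s²/4) − s. -/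
def Tinv (s : ℝ) : ℝ := Real.sqrt (1 - s ^ 2 / 4) - s

/-- T(u) = (2/5)(√(5 − u²) − 2u). -/
def Tfun (u : ℝ) : ℝ := 2 / 5 * (Real.sqrt (5 - u ^ 2) - 2 * u)

/-- s₁* = √((2 + √2)/3). -/
def s1star : ℝ := Real.sqrt ((2 + Real.sqrt 2) / 3)

/-- σ(s₁), the side length of the largest square fitting into a side pocket. -/
def sigma (s₁ : ℝ) : ℝ :=
  if s₁ ≤ s1star then
    1 / 4 * (-s₁ - 2 * Tinv s₁ + Real.sqrt (8 - (s₁ - 2 * Tinv s₁) ^ 2))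
  else
    1 / 5 * (Real.sqrt (20 - s₁ ^ 2) - 2 * s₁)

/-- w(y_t, h) = 2√(min{1 − y_t², 1 − (y_t − h)²}). -/
def wfun (yt h : ℝ) : ℝ := 2 * Real.sqrt (min (1 - yt ^ 2) (1 - (yt - h) ^ 2))

/-- X(a, b, u). -/
def Xfun (a b u : ℝ) : ℝ :=
  if u ≤ 2 * min a (-b) then Tinv u else Real.sqrt (1 - (u - min a (-b)) ^ 2) - u

/-- Y(a, h, w, h′) = w/2 − h + X(a, a − h, h′). -/
def Yfun (a h w h' : ℝ) : ℝ := w / 2 - h + Xfun a (a - h) h'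

/-- B₁(h, w, h′). -/
def B1 (h w h' : ℝ) : ℝ :=
  max (h * w / 2 + h ^ 2 / 4) (max (h ^ 2 + (w - h - h') * h') (h * (w + h) / 2 - h' ^ 2))

/-- B₂(h, w, h′). -/
def B2 (h w h' : ℝ) : ℝ :=
  if w < h + h' then h ^ 2
  else if w < 2 * h then h ^ 2 + h' ^ 2
  else B1 h w h'

/-- B₃(a, h, w, h′). -/
def B3 (a h w h' : ℝ) : ℝ :=
  max (h ^ 2 + max (Yfun a h w h') 0 * h')
      (h ^ 2 + min (max (Yfun a h w h') 0 ^ 2) (2 * h' ^ 2))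

/-- B₄(a, h, w, h′). -/
def B4 (a h w h' : ℝ) : ℝ := max (B2 h w h') (B3 a h w h')

/-- E(s₁, sₙ). -/
def Efun (s₁ sn : ℝ) : ℝ := if sn ≤ sigma s₁ then 0.83 * sigma s₁ ^ 2 else 0

/-- A(δ), the area of a circular segment of the unit disk of height δ. -/
def Aseg (δ : ℝ) : ℝ := Real.arccos (1 - δ) - (1 - δ) * Real.sqrt (1 - (1 - δ) ^ 2)

/-- B₅(h, H) = A(H − h) + h² − H·h. -/
def B5 (h H : ℝ) : ℝ := Aseg (H - h) + h ^ 2 - H * h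

/-- B₆(H_R, W_R, h′) = H_R·W_R/2 + h′·H_R/4. -/
def B6 (HR WR h' : ℝ) : ℝ := HR * WR / 2 + h' * HR / 4

theorem tangent_bound {s h n a y y₀ c₀ c₁ c₂ α γ s₀ s' : ℝ} (hy₀ : 0 ≤ y₀)
    (hc₂ : 0 ≤ c₂) (hc : 2 * y₀ * c₂ ≤ 1) (hconc : 1 ≤ 4 * y₀ * c₂ * γ ^ 2)
    (hs : s₀ ≤ s) (hs' : s ≤ s') (hss' : s₀ < s') (hhs : h ≤ s) (hns : n ≤ s)
    (ha : α - γ * s ≤ a) (hc₁ : c₁ ≤ 0.6 * c₂) (hhna : 0.6 ≤ h + n - 2 * a)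
    (hqh : c₀ + c₁ * (h - a) - c₂ * (h - a) ^ 2 ≤ √(1 - (h - a) ^ 2))
    (hqn : c₀ + c₁ * (n - a) - c₂ * (n - a) ^ 2 ≤ √(1 - (n - a) ^ 2))
    (hy : √(1 - (h - a) ^ 2) + √(1 - (n - a) ^ 2) - h - n ≤ y)
    (hends : ∀ t u, t = s₀ ∨ t = s' → u ≤ s' →
      8 / 5 < t ^ 2 + 2 * u ^ 2 + 2 * y₀ * (2 * c₀ + 2 * c₁ * (u - (α - γ * t))
        - 2 * c₂ * (u - (α - γ * t)) ^ 2 - 2 * u) - y₀ ^ 2) :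
    8 / 5 < s ^ 2 + h ^ 2 + n ^ 2 + y ^ 2 := by
  have h1 := hends s₀ ((h + n) / 2) (.inl rfl) (by linarith)
  have h2 := hends s' ((h + n) / 2) (.inr rfl) (by linarith)
  -- convexity in `s` between the two endpoints
  have h3 : 8 / 5 * (s' - s₀) < (s' - s₀) * (s ^ 2 + 2 * ((h + n) / 2) ^ 2
      + 2 * y₀ * (2 * c₀ + 2 * c₁ * ((h + n) / 2 - (α - γ * s))
        - 2 * c₂ * ((h + n) / 2 - (α - γ * s)) ^ 2 - 2 * ((h + n) / 2)) - y₀ ^ 2) := by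
    have hp := mul_nonneg (mul_nonneg (sub_nonneg.2 hs) (sub_nonneg.2 hs'))
      (mul_nonneg (sub_nonneg.2 hss'.le) (sub_nonneg.2 hconc))
    rcases eq_or_lt_of_le hs with rfl | hlt
    · nlinarith [mul_pos (sub_pos.2 hss') (sub_pos.2 h1)]
    · linarith [mul_nonneg (sub_nonneg.2 hs') (sub_nonneg.2 h1.le),
        mul_pos (sub_pos.2 hlt) (sub_pos.2 h2)]
  rw [mul_comm (8 / 5 : ℝ)] at h3
  have h4 := lt_of_mul_lt_mul_left h3 (sub_nonneg.2 hss'.le)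
  have h5 : 0 ≤ (a - (α - γ * s)) * (2 * (c₂ * (h + n - 2 * a) - c₁)
      + 2 * c₂ * (a - (α - γ * s))) := by
    have := sub_nonneg.2 ha
    have : 0 ≤ c₂ * (h + n - 2 * a) - c₁ := by
      linarith [mul_le_mul_of_nonneg_left hhna hc₂]
    positivity
  have h6 := mul_nonneg hy₀ (sub_nonneg.2 hy)
  have h6h := mul_le_mul_of_nonneg_left hqh hy₀
  have h6n := mul_le_mul_of_nonneg_left hqn hy₀
  have h7 := mul_nonneg hy₀ h5
  have h8 := mul_nonneg (sub_nonneg.2 hc) (sq_nonneg (h - n))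
  linarith [sq_nonneg (y - y₀)]

theorem quadratic_le_sqrt_narrow {x : ℝ} (h0 : 0 ≤ x) (h1 : x ≤ 0.48) :
    0.988 + 0.078 * x - 0.646 * x ^ 2 ≤ √(1 - x ^ 2) := by
  apply Real.le_sqrt_of_sq_le
  nlinarith [mul_nonneg h0 (sub_nonneg.2 h1), sq_nonneg (x - 0.35), sq_nonneg (x * (x - 0.35)),
    mul_nonneg h0 (sq_nonneg (x - 0.35)), mul_nonneg (sub_nonneg.2 h1) (sq_nonneg (x - 0.35))]

theorem quadratic_le_sqrt_medium {x : ℝ} (h0 : 0 ≤ x) (h1 : x ≤ 0.69) :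
    0.946 + 0.263 * x - 0.85 * x ^ 2 ≤ √(1 - x ^ 2) := by
  apply Real.le_sqrt_of_sq_le
  nlinarith [mul_nonneg h0 (sub_nonneg.2 h1), sq_nonneg (x - 0.46), sq_nonneg (x * (x - 0.46)),
    mul_nonneg h0 (sq_nonneg (x - 0.46)), mul_nonneg (sub_nonneg.2 h1) (sq_nonneg (x - 0.46)),
    mul_nonneg h0 (mul_nonneg (sub_nonneg.2 h1) (sq_nonneg (x - 0.46)))]

theorem quadratic_le_sqrt_wide {x : ℝ} (h0 : 0 ≤ x) (h1 : x ≤ 0.91) :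
    0.835 + 0.699 * x - 1.278 * x ^ 2 ≤ √(1 - x ^ 2) := by
  apply Real.le_sqrt_of_sq_le
  nlinarith [mul_nonneg h0 (sub_nonneg.2 h1), sq_nonneg (x - 0.5), sq_nonneg (x * (x - 0.5)),
    mul_nonneg h0 (sq_nonneg (x - 0.5)), mul_nonneg (sub_nonneg.2 h1) (sq_nonneg (x - 0.5)),
    mul_nonneg h0 (mul_nonneg (sub_nonneg.2 h1) (sq_nonneg (x - 0.5)))]

theorem quadratic_le_sqrt_wider {x : ℝ} (h0 : 0 ≤ x) (h1 : x ≤ 0.965) :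
    0.886 + 0.585 * x - 1.278 * x ^ 2 ≤ √(1 - x ^ 2) := by
  apply Real.le_sqrt_of_sq_le
  nlinarith [mul_nonneg h0 (sub_nonneg.2 h1), sq_nonneg (x - 0.4), sq_nonneg (x * (x - 0.4)),
    mul_nonneg h0 (sq_nonneg (x - 0.4)), mul_nonneg (sub_nonneg.2 h1) (sq_nonneg (x - 0.4)),
    mul_nonneg h0 (mul_nonneg (sub_nonneg.2 h1) (sq_nonneg (x - 0.4)))]

theorem quadratic_le_sqrt_unit {x : ℝ} (h0 : 0 ≤ x) (h1 : x ≤ 1) :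
    0.8 + 1.017 * x - 1.817 * x ^ 2 ≤ √(1 - x ^ 2) := by
  apply Real.le_sqrt_of_sq_le
  have : (1 - x) * (0.8 + 1.817 * x) ^ 2 ≤ 1 + x := by
    nlinarith [mul_nonneg h0 (sq_nonneg (x - 0.4))]
  nlinarith [mul_le_mul_of_nonneg_left this (sub_nonneg.2 h1)]

theorem max_bound {s h n a y : ℝ} (hs : 7071 / 10000 ≤ s) (hs' : s ≤ 1265 / 1000) (hhs : h ≤ s)
    (hns : n ≤ s) (ha : a = √(1 - s ^ 2 / 4) - s) (han : a ≤ n) (hha : h ≤ a + 1) (hnh : n ≤ h)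
    (hhna : 0.6 ≤ h + n - 2 * a)
    (hy : √(1 - (h - a) ^ 2) + √(1 - (n - a) ^ 2) - h - n ≤ y) :
    8 / 5 < s ^ 2 + h ^ 2 + n ^ 2 + y ^ 2 := by
  rcases le_total s 0.8 with h8 | h8
  · have ha' : 1.0792 - 1.2035 * s ≤ a := by
      have : 1.0792 - 0.2035 * s ≤ √(1 - s ^ 2 / 4) := Real.le_sqrt_of_sq_le (by nlinarith)
      linarith
    have h1 := quadratic_le_sqrt_medium (x := h - a) (by linarith) (by linarith)
    have h2 := quadratic_le_sqrt_medium (x := n - a) (by linarith) (by linarith)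
    rcases le_total s 0.76 with h76 | h76
    · refine tangent_bound (y₀ := 0.45) (s' := 0.76) (c₂ := 0.85) (by norm_num) (by norm_num)
        (by norm_num) (by norm_num) hs h76 (by norm_num) hhs hns ha' (by norm_num) hhna h1 h2 hy ?_
      rintro t u (rfl | rfl) hu
      · clear * - hu; nlinarith [sq_nonneg (u - 0.67)]
      · clear * - hu; nlinarith [sq_nonneg (u - 0.7)]
    · refine tangent_bound (y₀ := 0.42) (s' := 0.8) (c₂ := 0.85) (by norm_num) (by norm_num)
        (by norm_num) (by norm_num) h76 h8 (by norm_num) hhs hns ha' (by norm_num) hhna h1 h2 hy ?_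
      rintro t u (rfl | rfl) hu
      · clear * - hu; nlinarith [sq_nonneg (u - 0.67)]
      · clear * - hu; nlinarith [sq_nonneg (u - 0.8)]
  rcases le_total s 0.9 with h9 | h9
  · have ha' : 1.104 - 1.2348 * s ≤ a := by
      have : 1.104 - 0.2348 * s ≤ √(1 - s ^ 2 / 4) := Real.le_sqrt_of_sq_le (by nlinarith)
      linarith
    have h1 := quadratic_le_sqrt_wide (x := h - a) (by linarith) (by linarith)
    have h2 := quadratic_le_sqrt_wide (x := n - a) (by linarith) (by linarith)
    rcases le_total s 0.85 with h85 | h85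
    · refine tangent_bound (y₀ := 0.38) (s' := 0.85) (c₂ := 1.278) (by norm_num) (by norm_num)
        (by norm_num) (by norm_num) h8 h85 (by norm_num) hhs hns ha' (by norm_num) hhna h1 h2 hy ?_
      rintro t u (rfl | rfl) hu
      · clear * - hu; nlinarith [sq_nonneg (u - 0.67)]
      · clear * - hu; nlinarith [sq_nonneg (u - 0.8)]
    · refine tangent_bound (y₀ := 0.345) (s' := 0.9) (c₂ := 1.278) (by norm_num) (by norm_num)
        (by norm_num) (by norm_num) h85 h9 (by norm_num) hhs hns ha' (by norm_num) hhna h1 h2 hy ?_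
      rintro t u (rfl | rfl) hu
      · clear * - hu; nlinarith [sq_nonneg (u - 0.67)]
      · clear * - hu; nlinarith [sq_nonneg (u - 0.8)]
  have ha' : 1.185 - 1.3246 * s ≤ a := by
    have : 1.185 - 0.3246 * s ≤ √(1 - s ^ 2 / 4) := Real.le_sqrt_of_sq_le (by nlinarith)
    linarith
  rcases le_total s 0.95 with h95 | h95
  · by_contra! hcon
    have hh : h ≤ 0.89 := by nlinarith [sq_nonneg n, sq_nonneg y]
    have h1 := quadratic_le_sqrt_wider (x := h - a) (by linarith) (by linarith)
    have h2 := quadratic_le_sqrt_wider (x := n - a) (by linarith) (by linarith)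
    refine hcon.not_gt (tangent_bound (y₀ := 0.295) (s' := 0.95) (c₂ := 1.278) (by norm_num)
      (by norm_num) (by norm_num) (by norm_num) h9 h95 (by norm_num) hhs hns ha' (by norm_num)
      hhna h1 h2 hy ?_)
    rintro t u (rfl | rfl) hu
    · clear * - hu; nlinarith [sq_nonneg (u - 0.67)]
    · clear * - hu; nlinarith [sq_nonneg (u - 0.8)]
  have h1 := quadratic_le_sqrt_unit (x := h - a) (by linarith) (by linarith)
  have h2 := quadratic_le_sqrt_unit (x := n - a) (by linarith) (by linarith)
  rcases le_total s 1 with hs1 | hs1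
  · refine tangent_bound (y₀ := 0.235) (s' := 1) (c₂ := 1.817) (by norm_num) (by norm_num)
      (by norm_num) (by norm_num) h95 hs1 (by norm_num) hhs hns ha' (by norm_num) hhna h1 h2 hy ?_
    rintro t u (rfl | rfl) hu
    · clear * - hu; nlinarith [sq_nonneg (u - 0.67)]
    · clear * - hu; nlinarith [sq_nonneg (u - 0.8)]
  rcases le_total s 1.1 with hs2 | hs2
  · refine tangent_bound (y₀ := 0.205) (s' := 1.1) (c₂ := 1.817) (by norm_num) (by norm_num)
      (by norm_num) (by norm_num) hs1 hs2 (by norm_num) hhs hns ha' (by norm_num) hhna h1 h2 hy ?_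
    rintro t u (rfl | rfl) hu
    · clear * - hu; nlinarith [sq_nonneg (u - 0.67)]
    · clear * - hu; nlinarith [sq_nonneg (u - 0.8)]
  · refine tangent_bound (y₀ := 0.17) (s' := 1265 / 1000) (c₂ := 1.817) (by norm_num)
      (by norm_num) (by norm_num) (by norm_num)
      hs2 hs' (by norm_num) hhs hns ha' (by norm_num) hhna h1 h2 hy ?_
    rintro t u (rfl | rfl) hu
    · clear * - hu; nlinarith [sq_nonneg (u - 0.67)]
    · clear * - hu; nlinarith [sq_nonneg (u - 0.8)]

theorem max_bound_of_small {s h n a y : ℝ} (hs : 632 / 1000 ≤ s) (hs' : s ≤ 7072 / 10000)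
    (hhs : h ≤ s) (ha : 1.061 - 1.1777 * s ≤ a) (hmono : 0.6 ≤ h + n - 2 * a)
    (hc : s ^ 2 + h ^ 2 + 2 * n ^ 2 < 39 / 25)
    (hy : (0.988 + 0.078 * (h - a) - 0.646 * (h - a) ^ 2)
      + (0.988 + 0.078 * (n - a) - 0.646 * (n - a) ^ 2) - h - n ≤ y) :
    8 / 5 < s ^ 2 + h ^ 2 + n ^ 2 + y ^ 2 := by
  have key : ∀ t, t = 632 / 1000 ∨ t = 7072 / 10000 →
    8 / 5 < t ^ 2 + h ^ 2 + n ^ 2 + 1.3 * ((0.988 + 0.078 * (h - (1.061 - 1.1777 * t))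
      - 0.646 * (h - (1.061 - 1.1777 * t)) ^ 2)
      + (0.988 + 0.078 * (n - (1.061 - 1.1777 * t))
        - 0.646 * (n - (1.061 - 1.1777 * t)) ^ 2) - h - n) - 0.65 ^ 2
      + 0.2 * (t ^ 2 + h ^ 2 + 2 * n ^ 2 - 39 / 25) - 0.25 * (t - h) := by
    rintro t (rfl | rfl)
    · nlinarith [sq_nonneg (h - 0.62), sq_nonneg (n - 0.6)]
    · nlinarith [sq_nonneg (h - 0.62), sq_nonneg (n - 0.6)]
  have h5 : 0 ≤ (a - (1.061 - 1.1777 * s)) * (2 * (0.646 * (h + n - 2 * a) - 0.078)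
      + 2 * 0.646 * (a - (1.061 - 1.1777 * s))) := by
    have := sub_nonneg.2 ha
    have : 0 ≤ 0.646 * (h + n - 2 * a) - 0.078 := by linarith
    positivity
  nlinarith [sq_nonneg (y - 0.65), mul_nonneg (sub_nonneg.2 hs) (sub_nonneg.2 hs'),
    key _ (.inl rfl), key _ (.inr rfl),
   mul_nonneg (sub_nonneg.2 hs) (sub_nonneg.2 (key _ (.inr rfl)).le),
     mul_nonneg (sub_nonneg.2 hs') (sub_nonneg.2 (key _ (.inl rfl)).le)]

theorem one_sub_mul_sq_le_sqrt {x : ℝ} (hx : x ^ 2 ≤ 8 / 5) :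
    1 - 0.141 * x ^ 2 ≤ √(1 - x ^ 2 / 4) :=
  Real.le_sqrt_of_sq_le (by nlinarith [sq_nonneg x])

theorem one_sub_mul_sq_le_sqrt' {x : ℝ} (hx : x ^ 2 ≤ 1.21) :
    1 - 0.137 * x ^ 2 ≤ √(1 - x ^ 2 / 4) :=
  Real.le_sqrt_of_sq_le (by nlinarith [sq_nonneg x])

theorem one_sub_mul_sq_le_sqrt'' {x : ℝ} (hx : x ^ 2 ≤ 0.93) :
    1 - 0.134 * x ^ 2 ≤ √(1 - x ^ 2 / 4) :=
  Real.le_sqrt_of_sq_le (by nlinarith [sq_nonneg x])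

theorem le_sigma {s τ : ℝ} (hs : s ^ 2 ≤ 8 / 5)
    (h₁ : s ^ 2 - τ * s + 2 * τ ^ 2 ≤ 2 * √(1 - s ^ 2 / 4) * (s - τ))
    (h₂ : s ^ 2 + 4 * τ * s + 5 * τ ^ 2 ≤ 4) : τ ≤ sigma s := by
  have hp : √(1 - s ^ 2 / 4) ^ 2 = 1 - s ^ 2 / 4 := Real.sq_sqrt (by linarith)
  unfold sigma Tinv
  split_ifs
  · have := Real.le_sqrt_of_sq_le (x := 4 * τ - s + 2 * √(1 - s ^ 2 / 4))
      (y := 8 - (s - 2 * (√(1 - s ^ 2 / 4) - s)) ^ 2) (by nlinarith)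
    linarith
  · have := Real.le_sqrt_of_sq_le (x := 5 * τ + 2 * s) (y := 20 - s ^ 2) (by nlinarith)
    linarith

theorem sigma_ge {s : ℝ} (h0 : 0.632 ≤ s) (hs : s ^ 2 ≤ 8 / 5) : 0.35 ≤ sigma s := by
  have hs' : s ≤ 1.265 := by nlinarith
  refine le_sigma hs ?_ (by nlinarith)
  have := mul_le_mul_of_nonneg_right (one_sub_mul_sq_le_sqrt hs) (by linarith : 0 ≤ s - 0.35)
  have : 0 ≤ (s - 0.632) * (1.265 - s) := mul_nonneg (by linarith) (by linarith)
  nlinarith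

theorem sigma_ge' {s : ℝ} (h0 : 0.74 ≤ s) (hs : s ≤ 1.1) : 0.42 ≤ sigma s := by
  refine le_sigma (by nlinarith) ?_ (by nlinarith)
  have := mul_le_mul_of_nonneg_right (one_sub_mul_sq_le_sqrt' (x := s) (by nlinarith))
    (by linarith : 0 ≤ s - 0.42)
  have : 0 ≤ (s - 0.74) * (1.1 - s) := mul_nonneg (by linarith) (by linarith)
  nlinarith

theorem three_sq_bound {s h n : ℝ} (hn0 : 0 < n) (hnh : n ≤ h) (hhs : h ≤ s) (hs0 : 0.632 ≤ s)
    (hz : √(1 - s ^ 2 / 4) + √(1 - n ^ 2 / 4) < h + n + s) :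
    8 / 5 < s ^ 2 + h ^ 2 + 3 * n ^ 2 + Efun s n := by
  by_contra! hcon
  unfold Efun at hcon
  split_ifs at hcon with hns
  · have hs : s ^ 2 ≤ 8 / 5 := by nlinarith [sq_nonneg (sigma s)]
    have hσ := sigma_ge hs0 hs
    have hE : 0.35 ^ 2 ≤ sigma s ^ 2 := by gcongr
    have := one_sub_mul_sq_le_sqrt hs
    have := one_sub_mul_sq_le_sqrt (x := n) (by nlinarith)
    nlinarith [sq_nonneg (s - 0.894), sq_nonneg (h - 0.714), sq_nonneg (n - 0.255)]
  · have hs : s ^ 2 ≤ 8 / 5 := by nlinarith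
    push Not at hns
    have hσ := sigma_ge hs0 hs
    have hs1 : s ≤ 1.1 := by nlinarith
    have hn : n ^ 2 ≤ 8 / 5 := by nlinarith
    rcases le_total s 0.74 with hs2 | hs2
    · have := one_sub_mul_sq_le_sqrt'' (x := s) (by nlinarith)
      have := one_sub_mul_sq_le_sqrt'' (x := n) (by nlinarith)
      nlinarith [sq_nonneg (n - 0.42)]
    · have hσ' := sigma_ge' hs2 hs1
      have hs3 : s ^ 2 ≤ 0.93 := by nlinarith
      have := one_sub_mul_sq_le_sqrt'' hs3
      have := one_sub_mul_sq_le_sqrt'' (x := n) (by nlinarith)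
      nlinarith [sq_nonneg (s - 0.75), sq_nonneg (h - 0.625),
        mul_nonneg (sub_nonneg.2 (hσ'.trans hns.le)) (sub_nonneg.2 (hσ'.trans hns.le))]

theorem Efun_nonneg (s n : ℝ) : 0 ≤ Efun s n := by
  unfold Efun
  split_ifs <;> positivity

theorem sqrt_lt_of_Tfun_lt {u n : ℝ} (hn : 0 < n) (hn' : n ^ 2 ≤ 8 / 5) (h : Tfun u < n) :
    √(1 - n ^ 2 / 4) < u + n := by
  unfold Tfun at h
  have h1 : √(5 - u ^ 2) < 5 / 2 * n + 2 * u := by linarith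
  have h2 := (Real.sqrt_lt' ((Real.sqrt_nonneg _).trans_lt h1)).1 h1
  have h0 := (Real.sqrt_nonneg _).trans_lt h1
  have hpos : 0 < u + n := by nlinarith
  exact (Real.sqrt_lt' hpos).2 (by nlinarith)

theorem one_subcontainer (s₁ h₁ sn : ℝ)
    (hz0 : 0 < Tfun (h₁ - Tinv s₁)) (hzsn : Tfun (h₁ - Tinv s₁) < sn)
    (hsnh : sn ≤ h₁) (hhs : h₁ ≤ s₁) (hht : h₁ ≤ Tinv s₁ + 1)
    (hcond : s₁ > 1 / Real.sqrt 2 ∨ wfun (Tinv s₁) h₁ < 2 * h₁ ∨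
      s₁ ^ 2 + h₁ ^ 2 + 2 * sn ^ 2 < 39 / 25) :
    s₁ ^ 2 + B4 (Tinv s₁) h₁ (wfun (Tinv s₁) h₁) sn + sn ^ 2 + Efun s₁ sn > 8 / 5 := by
  by_contra! hF
  have hn0 : 0 < sn := hz0.trans hzsn
  have hh0 : 0 < h₁ := hn0.trans_le hsnh
  have hns : sn ≤ s₁ := hsnh.trans hhs
  have hE := Efun_nonneg s₁ sn
  have hB : h₁ ^ 2 + min (max (Yfun (Tinv s₁) h₁ (wfun (Tinv s₁) h₁) sn) 0 ^ 2) (2 * sn ^ 2)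
      ≤ B4 (Tinv s₁) h₁ (wfun (Tinv s₁) h₁) sn := le_max_of_le_right (le_max_right _ _)
  have hmin : 0 ≤ min (max (Yfun (Tinv s₁) h₁ (wfun (Tinv s₁) h₁) sn) 0 ^ 2) (2 * sn ^ 2) :=
    le_min (sq_nonneg _) (by positivity)
  have hs2 : s₁ ^ 2 ≤ 8 / 5 := by linarith [sq_nonneg h₁, sq_nonneg sn]
  have hsum : s₁ ^ 2 + h₁ ^ 2 + sn ^ 2 ≤ 8 / 5 := by linarith
  have hs_le : s₁ ≤ 1265 / 1000 := (abs_le_of_sq_le_sq' (hs2.trans (by norm_num)) (by norm_num)).2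
  have hn2 : sn ^ 2 ≤ 8 / 15 := by
    have : sn ^ 2 ≤ h₁ ^ 2 := by gcongr
    have : h₁ ^ 2 ≤ s₁ ^ 2 := by gcongr
    linarith
  have ha : Tinv s₁ = √(1 - s₁ ^ 2 / 4) - s₁ := rfl
  have hqn := sqrt_lt_of_Tfun_lt hn0 (by linarith) hzsn
  have hqp : √(1 - s₁ ^ 2 / 4) ≤ √(1 - sn ^ 2 / 4) := Real.sqrt_le_sqrt (by gcongr)
  have hp : √(1 - s₁ ^ 2 / 4) ^ 2 = 1 - s₁ ^ 2 / 4 := Real.sq_sqrt (by linarith)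
  have hp0 := Real.sqrt_nonneg (1 - s₁ ^ 2 / 4)
  have hs632 : 632 / 1000 ≤ s₁ := by
    have : √(1 - s₁ ^ 2 / 4) ^ 2 ≤ (3 / 2 * s₁) ^ 2 := by gcongr; linarith
    exact (abs_le_of_sq_le_sq' (by linarith : (632 / 1000) ^ 2 ≤ s₁ ^ 2) (by linarith)).2
  have hn731 : sn ≤ 0.731 := (abs_le_of_sq_le_sq' (hn2.trans (by norm_num)) (by norm_num)).2
  have hq93 : 0.93 ≤ √(1 - sn ^ 2 / 4) := Real.le_sqrt_of_sq_le (by linarith)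
  have hp95 : √(1 - s₁ ^ 2 / 4) ≤ 0.949 := Real.sqrt_le_iff.2 ⟨by norm_num,
    by nlinarith only [hs632]⟩
  have hhna : 0.6 ≤ h₁ + sn - 2 * Tinv s₁ := by linarith
  have h2a : 2 * Tinv s₁ < h₁ := by
    by_contra! h
    have : √(1 - s₁ ^ 2 / 4) ≤ √(1 - h₁ ^ 2 / 4) := Real.sqrt_le_sqrt (by gcongr)
    have : √(1 - h₁ ^ 2 / 4) ≤ √(1 - sn ^ 2 / 4) := Real.sqrt_le_sqrt (by gcongr)
    linarith
  have n2a : 2 * Tinv s₁ < sn := by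
    by_contra! h
    linarith
  have hY : Yfun (Tinv s₁) h₁ (wfun (Tinv s₁) h₁) sn
      = √(1 - (h₁ - Tinv s₁) ^ 2) + √(1 - (sn - Tinv s₁) ^ 2) - h₁ - sn := by
    have hc : min (Tinv s₁) (-(Tinv s₁ - h₁)) = Tinv s₁ := min_eq_left (by linarith)
    have hw : min (1 - Tinv s₁ ^ 2) (1 - (Tinv s₁ - h₁) ^ 2) = 1 - (h₁ - Tinv s₁) ^ 2 := by
      rw [min_eq_right (by nlinarith only [h2a, hn0, hsnh])]
      ring
    rw [Yfun, Xfun, hc, if_neg n2a.not_ge, wfun, hw]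
    ring
  have han : Tinv s₁ ≤ sn := by linarith
  have hy := hY.ge.trans (le_max_left _ 0)
  rcases le_total (2 * sn ^ 2) (max (Yfun (Tinv s₁) h₁ (wfun (Tinv s₁) h₁) sn) 0 ^ 2) with hc | hc
  · rw [min_eq_right hc] at hB
    linarith [three_sq_bound hn0 hsnh hhs (by linarith) (by linarith)]
  rw [min_eq_left hc] at hB
  refine absurd ?_ (not_lt.2 (by linarith : s₁ ^ 2 + h₁ ^ 2 + sn ^ 2
    + max (Yfun (Tinv s₁) h₁ (wfun (Tinv s₁) h₁) sn) 0 ^ 2 ≤ 8 / 5))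
  rcases le_total (7071 / 10000) s₁ with h7 | h7
  · exact max_bound h7 hs_le hhs hns ha han hht hsnh hhna hy
  have ha' : 1.061 - 1.1777 * s₁ ≤ Tinv s₁ := by
    have : 1.061 - 0.1777 * s₁ ≤ √(1 - s₁ ^ 2 / 4) := Real.le_sqrt_of_sq_le (by
        nlinarith only [h7, hs632])
    linarith
  have h48 : h₁ - Tinv s₁ ≤ 0.48 := by linarith
  have hah : Tinv s₁ ≤ h₁ := han.trans hsnh
  have hqh := quadratic_le_sqrt_narrow (by linarith) h48
  have hqn := quadratic_le_sqrt_narrow (x := sn - Tinv s₁) (by linarith) (by linarith)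
  refine max_bound_of_small hs632 (by linarith) hhs ha' hhna ?_ (by linarith)
  rcases hcond with hcond | hcond | hcond
  · have : s₁ ≤ 1 / √2 := by
      rw [le_div_iff₀ (by positivity)]
      nlinarith only [h7, hs632, Real.sqrt_nonneg 2, Real.sq_sqrt (show (0 : ℝ) ≤ 2 by norm_num)]
    linarith
  · have : h₁ ≤ √(1 - (h₁ - Tinv s₁) ^ 2) :=
      Real.le_sqrt_of_sq_le (by nlinarith only [h48, h2a, hhs, h7, hn0, hsnh, hah])
    have hw : 2 * √(1 - (h₁ - Tinv s₁) ^ 2) ≤ wfun (Tinv s₁) h₁ := by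
      unfold wfun
      gcongr
      exact le_min (by nlinarith only [h2a, hn0, hsnh]) (by linarith)
    linarith
  · exact hcond
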